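/- Let v: ℝⁿ → ℝ be L-Lipschitz and let (X,Y) be ρ-correlated standard Gaussians, 0 ≤ ρ < 1. If β > 0 satisfies 4βL² < 1, then E_ρ exp(β(v(X) - v(Y))²/(1-ρ)) ≤ 1/√(1 - 4βL²). -/

import Mathlib

open MeasureTheory Real ProbabilityTheory

noncomputable section

/-- The standard Gaussian measure on ℝⁿ. -/
def stdGaussian (n : ℕ) : Measure (Fin n → ℝ) := Measure.pi fun _ => gaussianReal 0 1

/-- The joint law of a pair of ρ-correlated standard Gaussian vectors on ℝⁿ. -/
def jointGaussian (n : ℕ) (ρ : ℝ) : Measure ((Fin n → ℝ) × (Fin n → ℝ)) :=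
  Measure.map (fun p => (p.1, fun i => ρ * p.1 i + Real.sqrt (1 - ρ ^ 2) * p.2 i))
    ((stdGaussian n).prod (stdGaussian n))

open scoped ENNReal Pointwise

/-- One-dimensional Brunn–Minkowski inequality for compact sets. -/
lemma volume_add_volume_le_of_isCompact {A B : Set ℝ} (hA : IsCompact A) (hB : IsCompact B)
    (hA' : A.Nonempty) (hB' : B.Nonempty) : volume A + volume B ≤ volume (A + B) := by
  obtain ⟨a, haA, ha⟩ := hA.exists_isGreatest hA'
  obtain ⟨b, hbB, hb⟩ := hB.exists_isLeast hB'
  have hdisj : AEDisjoint volume ((fun x => x + b) '' A) ((fun x => a + x) '' B) := by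
    refine measure_mono_null (t := {a + b}) ?_ (by simp)
    rintro _ ⟨⟨x, hx, rfl⟩, y, hy, hxy⟩
    have h1 := ha hx
    have h2 := hb hy
    simp only at hxy
    simp only [Set.mem_singleton_iff]
    linarith
  have hmeas : NullMeasurableSet ((fun x => a + x) '' B) volume :=
    (hB.image (by fun_prop)).measurableSet.nullMeasurableSet
  calc volume A + volume B
      = volume ((fun x => x + b) '' A) + volume ((fun x => a + x) '' B) := by simp
    _ = volume ((fun x => x + b) '' A ∪ (fun x => a + x) '' B) :=
        (measure_union₀ hmeas hdisj).symm
    _ ≤ volume (A + B) := by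
        refine measure_mono (Set.union_subset ?_ ?_)
        · rintro _ ⟨x, hx, rfl⟩
          exact Set.add_mem_add hx hbB
        · rintro _ ⟨x, hx, rfl⟩
          exact Set.add_mem_add haA hx

/-- One-dimensional Brunn–Minkowski inequality. -/
lemma volume_add_volume_le {A B : Set ℝ} (hA : MeasurableSet A) (hB : MeasurableSet B)
    (hA' : A.Nonempty) (hB' : B.Nonempty) : volume A + volume B ≤ volume (A + B) := by
  obtain ⟨a, ha⟩ := hA'
  obtain ⟨b, hb⟩ := hB'
  have key : ∀ K ⊆ A, IsCompact K → ∀ K' ⊆ B, IsCompact K' →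
      volume K + volume K' ≤ volume (A + B) := by
    intro K hKA hK K' hKB hK'
    calc volume K + volume K' ≤ volume (insert a K) + volume (insert b K') := by
          gcongr <;> exact Set.subset_insert _ _
      _ ≤ volume (insert a K + insert b K') :=
          volume_add_volume_le_of_isCompact (hK.insert a) (hK'.insert b) ⟨a, by simp⟩ ⟨b, by simp⟩
      _ ≤ volume (A + B) := by
          gcongr
          · exact Set.insert_subset ha hKA
          · exact Set.insert_subset hb hKB
  refine le_of_forall_lt fun r hr => ?_
  by_contra! hle
  have hlt : volume (A + B) < volume A + volume B := hle.trans_lt hr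
  have hA1 : volume A ≤ volume (A + B) := by
    calc volume A = volume ((fun x => x + b) '' A) := by simp
      _ ≤ _ := measure_mono (by rintro _ ⟨x, hx, rfl⟩; exact Set.add_mem_add hx hb)
  have hB1 : volume B ≤ volume (A + B) := by
    calc volume B = volume ((fun x => a + x) '' B) := by simp
      _ ≤ _ := measure_mono (by rintro _ ⟨x, hx, rfl⟩; exact Set.add_mem_add ha hx)
  by_cases hA0 : volume A = 0
  · rw [hA0, zero_add] at hlt
    exact absurd hlt (not_lt.2 hB1)
  by_cases hB0 : volume B = 0
  · rw [hB0, add_zero] at hlt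
    exact absurd hlt (not_lt.2 hA1)
  obtain ⟨u, hu, w, hw, huw⟩ := ENNReal.exists_lt_add_of_lt_add hlt hA0 hB0
  obtain ⟨K, hKA, hK, hKu⟩ := hA.exists_lt_isCompact hu
  obtain ⟨K', hKB, hK', hKw⟩ := hB.exists_lt_isCompact hw
  exact not_lt.2 (key K hKA hK K' hKB hK') (huw.trans_le (add_le_add hKu.le hKw.le))

/-- Normalised form of the Prékopa–Leindler inequality on the line. -/
lemma lintegral_add_lintegral_le_of_midpoint {F G H : ℝ → ℝ} (hF : Measurable F)
    (hG : Measurable G) (hH : Measurable H) (hF0 : ∀ s, 0 ≤ F s) (hG0 : ∀ s, 0 ≤ G s)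
    (hH0 : ∀ s, 0 ≤ H s) (hF1 : ∀ s, F s ≤ 1) (hG1 : ∀ s, G s ≤ 1)
    (hF2 : ∀ r < 1, ∃ s, r < F s) (hG2 : ∀ r < 1, ∃ s, r < G s)
    (hFGH : ∀ s t, F s * G t ≤ H ((s + t) / 2) ^ 2) :
    (∫⁻ s, ENNReal.ofReal (F s)) + ∫⁻ s, ENNReal.ofReal (G s)
      ≤ 2 * ∫⁻ s, ENNReal.ofReal (H s) := by
  have hmono : ∀ f : ℝ → ℝ, Measurable fun t : ℝ => volume {a | t < f a} := fun f =>
    Antitone.measurable fun s t hst => measure_mono fun a ha => lt_of_le_of_lt hst ha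
  rw [lintegral_eq_lintegral_meas_lt _ (.of_forall hF0) hF.aemeasurable,
    lintegral_eq_lintegral_meas_lt _ (.of_forall hG0) hG.aemeasurable,
    lintegral_eq_lintegral_meas_lt _ (.of_forall hH0) hH.aemeasurable,
    ← lintegral_add_left (hmono F), ← lintegral_const_mul _ (hmono H)]
  refine setLIntegral_mono ((hmono H).const_mul _) fun r hr => ?_
  have hr0 : 0 < r := hr
  rcases le_or_gt 1 r with hr1 | hr1
  · have h1 : {a | r < F a} = ∅ := by ext a; simpa using (hF1 a).trans hr1
    have h2 : {a | r < G a} = ∅ := by ext a; simpa using (hG1 a).trans hr1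
    simp [h1, h2]
  · refine (volume_add_volume_le (measurableSet_lt measurable_const hF)
      (measurableSet_lt measurable_const hG) (hF2 r hr1) (hG2 r hr1)).trans ?_
    have hsmul : volume ((2 : ℝ) • {a | r < H a}) = 2 * volume {a | r < H a} := by
      simp [Measure.addHaar_smul]
    rw [← hsmul]
    refine measure_mono ?_
    rintro _ ⟨s, hs, t, ht, rfl⟩
    refine ⟨(s + t) / 2, ?_, by simp; ring⟩
    simp only [Set.mem_ofPred_eq] at hs ht ⊢
    have h := hFGH s t
    refine lt_of_pow_lt_pow_left₀ 2 (hH0 _) (lt_of_lt_of_le ?_ h)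
    rw [sq]
    exact mul_lt_mul'' hs ht hr0.le hr0.le

lemma ENNReal.mul_le_sq_of_add_le_two_mul {x y z : ℝ≥0∞} (h : x + y ≤ 2 * z) :
    x * y ≤ z ^ 2 := by
  by_cases hz : z = ∞
  · simp [hz]
  have hx : x ≠ ∞ := ne_top_of_le_ne_top (ENNReal.mul_ne_top (by simp) hz) (le_self_add.trans h)
  have hy : y ≠ ∞ := ne_top_of_le_ne_top (ENNReal.mul_ne_top (by simp) hz) (le_add_self.trans h)
  lift x to NNReal using hx
  lift y to NNReal using hy
  lift z to NNReal using hz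
  norm_cast at h ⊢
  rw [← NNReal.coe_le_coe] at h ⊢
  push_cast at h ⊢
  nlinarith [sq_nonneg ((x : ℝ) - y), x.coe_nonneg, y.coe_nonneg]

/-- Prékopa–Leindler inequality on the line, with weights `1 / 2`. -/
lemma lintegral_mul_lintegral_le_sq_of_midpoint {F G : ℝ → ℝ≥0∞} {H : ℝ → ℝ} {M : ℝ}
    (hF : Measurable F) (hG : Measurable G) (hH : Measurable H)
    (hH0 : ∀ s, 0 ≤ H s) (hM : ∀ s, H s ≤ M)
    (hFGH : ∀ s t, F s * G t ≤ ENNReal.ofReal (H ((s + t) / 2) ^ 2)) :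
    (∫⁻ s, F s) * ∫⁻ s, G s ≤ (∫⁻ s, ENNReal.ofReal (H s)) ^ 2 := by
  by_cases hFz : ∀ s, F s = 0
  · simp [hFz]
  by_cases hGz : ∀ s, G s = 0
  · simp [hGz]
  push Not at hFz hGz
  obtain ⟨s₀, hs₀⟩ := hFz
  obtain ⟨t₀, ht₀⟩ := hGz
  have hbound : ∀ s t, F s * G t ≤ ENNReal.ofReal (M ^ 2) := fun s t =>
    (hFGH s t).trans (ENNReal.ofReal_le_ofReal (pow_le_pow_left₀ (hH0 _) (hM _) 2))
  have hFtop : ∀ s, F s ≠ ∞ := fun s hs => by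
    have := hbound s t₀
    simp [hs, ENNReal.top_mul ht₀] at this
  have hGtop : ∀ s, G s ≠ ∞ := fun s hs => by
    have := hbound s₀ s
    simp [hs, ENNReal.mul_top hs₀] at this
  have hreal : ∀ s t, (F s).toReal * (G t).toReal ≤ H ((s + t) / 2) ^ 2 := fun s t => by
    rw [← ENNReal.toReal_mul]
    exact ENNReal.toReal_le_of_le_ofReal (sq_nonneg _) (hFGH s t)
  have hMreal : ∀ s t, (F s).toReal * (G t).toReal ≤ M ^ 2 := fun s t =>
    (hreal s t).trans (pow_le_pow_left₀ (hH0 _) (hM _) 2)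
  have hFpos := ENNReal.toReal_pos hs₀ (hFtop s₀)
  have hGpos := ENNReal.toReal_pos ht₀ (hGtop t₀)
  have hFbdd : BddAbove (Set.range fun s => (F s).toReal) :=
    ⟨M ^ 2 / (G t₀).toReal, by rintro _ ⟨s, rfl⟩; exact (le_div_iff₀ hGpos).2 (hMreal s t₀)⟩
  have hGbdd : BddAbove (Set.range fun s => (G s).toReal) :=
    ⟨M ^ 2 / (F s₀).toReal, by
      rintro _ ⟨s, rfl⟩; exact (le_div_iff₀' hFpos).2 (hMreal s₀ s)⟩
  set a := ⨆ s, (F s).toReal with ha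
  set b := ⨆ s, (G s).toReal with hb
  have hapos : 0 < a := hFpos.trans_le (le_ciSup hFbdd s₀)
  have hbpos : 0 < b := hGpos.trans_le (le_ciSup hGbdd t₀)
  have hab : √(a * b) ^ 2 = a * b := Real.sq_sqrt (by positivity)
  have habpos : 0 < √(a * b) := by positivity
  have key := lintegral_add_lintegral_le_of_midpoint
    (F := fun s => (F s).toReal / a) (G := fun s => (G s).toReal / b)
    (H := fun s => H s / √(a * b)) (by fun_prop) (by fun_prop) (by fun_prop)
    (fun s => by positivity) (fun s => by positivity)
    (fun s => div_nonneg (hH0 s) habpos.le)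
    (fun s => (div_le_one hapos).2 (le_ciSup hFbdd s))
    (fun s => (div_le_one hbpos).2 (le_ciSup hGbdd s))
    (fun r hr => by
      obtain ⟨s, hs⟩ := exists_lt_of_lt_ciSup
        (show r * a < ⨆ s, (F s).toReal by rw [← ha]; nlinarith)
      exact ⟨s, (lt_div_iff₀ hapos).2 hs⟩)
    (fun r hr => by
      obtain ⟨s, hs⟩ := exists_lt_of_lt_ciSup
        (show r * b < ⨆ s, (G s).toReal by rw [← hb]; nlinarith)
      exact ⟨s, (lt_div_iff₀ hbpos).2 hs⟩)
    (fun s t => by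
      rw [div_mul_div_comm, div_pow, hab]
      gcongr
      exact hreal s t)
  have hdiv : ∀ (c : ℝ), 0 < c → ∀ f : ℝ → ℝ, Measurable f →
      ∫⁻ s, ENNReal.ofReal (f s / c) = (∫⁻ s, ENNReal.ofReal (f s)) / ENNReal.ofReal c := by
    intro c hc f hf
    simp_rw [ENNReal.ofReal_div_of_pos hc, div_eq_mul_inv]
    exact lintegral_mul_const _ (by fun_prop)
  rw [hdiv a hapos _ hF.ennreal_toReal, hdiv b hbpos _ hG.ennreal_toReal, hdiv _ habpos _ hH] at key
  simp only [ENNReal.ofReal_toReal (hFtop _), ENNReal.ofReal_toReal (hGtop _)] at key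
  have h := ENNReal.mul_le_sq_of_add_le_two_mul key
  have ha0 : ENNReal.ofReal a ≠ 0 := by simpa using hapos
  have hb0 : ENNReal.ofReal b ≠ 0 := by simpa using hbpos
  have hsq : ENNReal.ofReal √(a * b) ^ 2 = ENNReal.ofReal a * ENNReal.ofReal b := by
    rw [← ENNReal.ofReal_pow habpos.le, hab, ENNReal.ofReal_mul hapos.le]
  calc (∫⁻ s, F s) * ∫⁻ s, G s
      = ((∫⁻ s, F s) / ENNReal.ofReal a * ENNReal.ofReal a) *
          ((∫⁻ s, G s) / ENNReal.ofReal b * ENNReal.ofReal b) := by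
        rw [ENNReal.div_mul_cancel ha0 (by simp), ENNReal.div_mul_cancel hb0 (by simp)]
    _ = ((∫⁻ s, F s) / ENNReal.ofReal a * ((∫⁻ s, G s) / ENNReal.ofReal b)) *
          ENNReal.ofReal √(a * b) ^ 2 := by rw [hsq]; ring
    _ ≤ ((∫⁻ s, ENNReal.ofReal (H s)) / ENNReal.ofReal √(a * b)) ^ 2 *
          ENNReal.ofReal √(a * b) ^ 2 := by gcongr
    _ = (∫⁻ s, ENNReal.ofReal (H s)) ^ 2 := by
        rw [← mul_pow, ENNReal.div_mul_cancel (by simpa using habpos) (by simp)]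

/-- Maurey's property (τ) for the Gaussian measure on the line. -/
lemma lintegral_mul_lintegral_gaussianReal_le {f g : ℝ → ℝ≥0∞} (hf : Measurable f)
    (hg : Measurable g) {c : ℝ≥0∞} (hc0 : c ≠ 0) (hc : c ≠ ∞)
    (hfg : ∀ s t, f s * g t ≤ c * ENNReal.ofReal (exp ((s - t) ^ 2 / 4))) :
    (∫⁻ s, f s ∂gaussianReal 0 1) * ∫⁻ s, g s ∂gaussianReal 0 1 ≤ c := by
  have hφ : Measurable (gaussianPDF 0 1) := measurable_gaussianPDF 0 1
  have hpdf : ∀ s, gaussianPDFReal 0 1 s = (√(2 * π))⁻¹ * exp (-s ^ 2 / 2) := fun s => by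
    simp [gaussianPDFReal_def]
  have key := lintegral_mul_lintegral_le_sq_of_midpoint
    (F := fun s => c⁻¹ * (gaussianPDF 0 1 s * f s)) (G := fun s => gaussianPDF 0 1 s * g s)
    (H := gaussianPDFReal 0 1) (M := (√(2 * π))⁻¹) (by fun_prop) (by fun_prop)
    (measurable_gaussianPDFReal 0 1) (gaussianPDFReal_nonneg 0 1)
    (fun s => by
      rw [hpdf]
      refine mul_le_of_le_one_right (by positivity) (exp_le_one_iff.2 ?_)
      nlinarith [sq_nonneg s])
    (fun s t => by
      calc c⁻¹ * (gaussianPDF 0 1 s * f s) * (gaussianPDF 0 1 t * g t)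
          = c⁻¹ * (gaussianPDF 0 1 s * gaussianPDF 0 1 t * (f s * g t)) := by ring
        _ ≤ c⁻¹ * (gaussianPDF 0 1 s * gaussianPDF 0 1 t *
              (c * ENNReal.ofReal (exp ((s - t) ^ 2 / 4)))) :=
            mul_le_mul_right (mul_le_mul_right (hfg s t) _) _
        _ = c⁻¹ * c * (gaussianPDF 0 1 s * gaussianPDF 0 1 t *
              ENNReal.ofReal (exp ((s - t) ^ 2 / 4))) := by ring
        _ = ENNReal.ofReal (gaussianPDFReal 0 1 ((s + t) / 2) ^ 2) := by
            rw [ENNReal.inv_mul_cancel hc0 hc, one_mul, gaussianPDF, gaussianPDF,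
              ← ENNReal.ofReal_mul (gaussianPDFReal_nonneg _ _ _),
              ← ENNReal.ofReal_mul (mul_nonneg (gaussianPDFReal_nonneg _ _ _)
                (gaussianPDFReal_nonneg _ _ _)), hpdf, hpdf, hpdf]
            congr 1
            rw [mul_pow, ← exp_nat_mul, mul_mul_mul_comm, mul_assoc, ← exp_add, ← exp_add, ← sq]
            congr 2
            push_cast
            ring
        _ ≤ _ := le_rfl)
  have hint : ∀ h : ℝ → ℝ≥0∞, Measurable h →
      ∫⁻ s, h s ∂gaussianReal 0 1 = ∫⁻ s, gaussianPDF 0 1 s * h s := fun h hh => by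
    rw [gaussianReal_of_var_ne_zero 0 one_ne_zero, lintegral_withDensity_eq_lintegral_mul _ hφ hh]
    rfl
  rw [lintegral_gaussianPDFReal_eq_one 0 one_ne_zero, one_pow,
    lintegral_const_mul _ (by fun_prop), ← hint f hf, ← hint g hg, mul_assoc] at key
  calc _ = c * (c⁻¹ * ((∫⁻ s, f s ∂gaussianReal 0 1) * ∫⁻ s, g s ∂gaussianReal 0 1)) := by
        rw [← mul_assoc, ENNReal.mul_inv_cancel hc0 hc, one_mul]
    _ ≤ c * 1 := by gcongr
    _ = c := mul_one c

instance (n : ℕ) : IsProbabilityMeasure (_root_.stdGaussian n) := by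
  unfold _root_.stdGaussian; infer_instance

lemma lintegral_stdGaussian_succ {n : ℕ} {f : (Fin (n + 1) → ℝ) → ℝ≥0∞} (hf : Measurable f) :
    ∫⁻ x, f x ∂_root_.stdGaussian (n + 1)
      = ∫⁻ x, ∫⁻ s, f (Fin.cons s x) ∂gaussianReal 0 1 ∂_root_.stdGaussian n := by
  have h := measurePreserving_piFinSuccAbove (fun _ : Fin (n + 1) => gaussianReal 0 1) 0
  have h' := h.symm.lintegral_comp hf
  rw [_root_.stdGaussian, ← h', lintegral_prod_symm _ (by fun_prop)]
  simp only [MeasurableEquiv.piFinSuccAbove_symm_apply, Fin.insertNthEquiv_zero]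
  rfl

/-- Maurey's property (τ) for the standard Gaussian measure on `ℝⁿ`. -/
lemma lintegral_mul_lintegral_stdGaussian_le (n : ℕ) {f g : (Fin n → ℝ) → ℝ≥0∞}
    (hf : Measurable f) (hg : Measurable g)
    (hfg : ∀ x y, f x * g y ≤ ENNReal.ofReal (exp ((∑ i, (x i - y i) ^ 2) / 4))) :
    (∫⁻ x, f x ∂_root_.stdGaussian n) * ∫⁻ x, g x ∂_root_.stdGaussian n ≤ 1 := by
  induction n with
  | zero =>
    have h : ∀ f : (Fin 0 → ℝ) → ℝ≥0∞, ∫⁻ x, f x ∂_root_.stdGaussian 0 = f 0 := fun f => by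
      rw [lintegral_unique, measure_univ, mul_one]
      exact congrArg f (Subsingleton.elim _ _)
    rw [h, h]
    simpa using hfg 0 0
  | succ n ih =>
    have hcons : Measurable fun p : (Fin n → ℝ) × ℝ => (Fin.cons p.2 p.1 : Fin (n + 1) → ℝ) := by
      refine measurable_pi_iff.2 fun i => ?_
      refine Fin.cases ?_ (fun j => ?_) i
      · simpa using measurable_snd
      · simp only [Fin.cons_succ]
        fun_prop
    have hslice : ∀ {f : (Fin (n + 1) → ℝ) → ℝ≥0∞}, Measurable f →
        Measurable fun x : Fin n → ℝ => ∫⁻ s, f (Fin.cons s x) ∂gaussianReal 0 1 :=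
      fun hf => (hf.comp hcons).lintegral_prod_right'
    rw [lintegral_stdGaussian_succ hf, lintegral_stdGaussian_succ hg]
    refine ih (hslice hf) (hslice hg) fun x y => ?_
    refine lintegral_mul_lintegral_gaussianReal_le
      (c := ENNReal.ofReal (exp ((∑ i, (x i - y i) ^ 2) / 4)))
      (hf.comp (hcons.comp measurable_prodMk_left)) (hg.comp (hcons.comp measurable_prodMk_left))
      (by simp [exp_pos]) (by simp) fun s t => ?_
    refine (hfg _ _).trans_eq ?_
    rw [← ENNReal.ofReal_mul (exp_pos _).le, ← exp_add, Fin.sum_univ_succ]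
    congr 2
    simp only [Function.comp_apply, Fin.cons_zero, Fin.cons_succ]
    ring

lemma measurePreserving_neg_stdGaussian (n : ℕ) :
    MeasurePreserving (fun x : Fin n → ℝ => -x) (_root_.stdGaussian n) (_root_.stdGaussian n) :=
  measurePreserving_pi _ _ fun _ => ⟨measurable_neg, by
    have h := gaussianReal_map_neg (μ := 0) (v := 1)
    rwa [neg_zero] at h⟩

/-- Sub-Gaussian moment bound, with the sharp constant, for an odd Lipschitz function. -/
lemma lintegral_exp_stdGaussian_le_of_odd {n : ℕ} {h : (Fin n → ℝ) → ℝ} (hm : Measurable h)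
    (hodd : ∀ x, h (-x) = -h x) {K : ℝ}
    (hK : ∀ x y, |h x - h y| ≤ K * √(∑ i, (x i - y i) ^ 2)) :
    ∫⁻ x, ENNReal.ofReal (exp (h x)) ∂_root_.stdGaussian n ≤ ENNReal.ofReal (exp (K ^ 2 / 2)) := by
  set f : (Fin n → ℝ) → ℝ≥0∞ := fun x => ENNReal.ofReal (exp (h x - K ^ 2 / 2)) with hf
  have hfm : Measurable f := by fun_prop
  have key := lintegral_mul_lintegral_stdGaussian_le n hfm (hfm.comp measurable_neg) fun x y => by
    simp only [hf, Function.comp_apply, hodd]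
    rw [← ENNReal.ofReal_mul (exp_pos _).le, ← exp_add]
    refine ENNReal.ofReal_le_ofReal (exp_le_exp.2 ?_)
    have h1 := (le_abs_self _).trans (hK x y)
    have h2 : √(∑ i, (x i - y i) ^ 2) ^ 2 = ∑ i, (x i - y i) ^ 2 :=
      sq_sqrt (Finset.sum_nonneg fun i _ => sq_nonneg _)
    nlinarith [sq_nonneg (K - √(∑ i, (x i - y i) ^ 2) / 2)]
  have hneg : ∫⁻ x, (f ∘ Neg.neg) x ∂_root_.stdGaussian n = ∫⁻ x, f x ∂_root_.stdGaussian n :=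
    (measurePreserving_neg_stdGaussian n).lintegral_comp hfm
  rw [hneg, ← sq] at key
  have hle : ∫⁻ x, f x ∂_root_.stdGaussian n ≤ 1 := by
    by_contra! hlt
    exact absurd key (not_le.2 (one_lt_pow₀ hlt two_ne_zero))
  calc ∫⁻ x, ENNReal.ofReal (exp (h x)) ∂_root_.stdGaussian n
      = ∫⁻ x, ENNReal.ofReal (exp (K ^ 2 / 2)) * f x ∂_root_.stdGaussian n := by
        refine lintegral_congr fun x => ?_
        rw [hf, ← ENNReal.ofReal_mul (exp_pos _).le, ← exp_add]
        ring_nf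
    _ = ENNReal.ofReal (exp (K ^ 2 / 2)) * ∫⁻ x, f x ∂_root_.stdGaussian n :=
        lintegral_const_mul _ hfm
    _ ≤ ENNReal.ofReal (exp (K ^ 2 / 2)) * 1 := by gcongr
    _ = _ := mul_one _

/-- The law of a pair of independent standard Gaussian vectors is rotation invariant. -/
lemma map_rotation_stdGaussian (n : ℕ) (θ : ℝ) :
    ((_root_.stdGaussian n).prod (_root_.stdGaussian n)).map (ContinuousLinearMap.rotation θ)
      = (_root_.stdGaussian n).prod (_root_.stdGaussian n) := by
  have hstd : _root_.stdGaussian n = (ProbabilityTheory.stdGaussian (EuclideanSpace ℝ (Fin n))).map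
      (EuclideanSpace.equiv (Fin n) ℝ) := by
    rw [← map_pi_eq_stdGaussian, Measure.map_map (by fun_prop) (by fun_prop)]
    exact Measure.map_id.symm
  have : IsGaussian (_root_.stdGaussian n) := by
    rw [hstd]
    infer_instance
  refine IsGaussian.map_rotation_eq_self_of_forall_strongDual_eq_zero (fun L => ?_) θ
  rw [hstd, integral_map (by fun_prop) (by fun_prop)]
  exact integral_strongDual_stdGaussian
    (L.comp (EuclideanSpace.equiv (Fin n) ℝ : EuclideanSpace ℝ (Fin n) →L[ℝ] Fin n → ℝ))

lemma measurable_of_le_mul_sqrt_sum_sq {n : ℕ} {v : (Fin n → ℝ) → ℝ} {L : ℝ}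
    (hLip : ∀ x y, |v x - v y| ≤ L * √(∑ i, (x i - y i) ^ 2)) : Measurable v := by
  refine Continuous.measurable (continuous_iff_continuousAt.2 fun x => ?_)
  refine tendsto_iff_dist_tendsto_zero.2 (squeeze_zero (fun _ => dist_nonneg) (fun y => hLip y x) ?_)
  have hc : Continuous fun y : Fin n → ℝ => L * √(∑ i, (y i - x i) ^ 2) := by fun_prop
  simpa using hc.tendsto x

/-- The increment of a Lipschitz function along a `ρ`-correlated pair is sub-Gaussian. -/
lemma lintegral_exp_sub_jointGaussian_le {n : ℕ} {v : (Fin n → ℝ) → ℝ} {L : ℝ}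
    (hLip : ∀ x y, |v x - v y| ≤ L * √(∑ i, (x i - y i) ^ 2))
    {ρ : ℝ} (hρ : ρ ∈ Set.Icc (-1 : ℝ) 1) (c : ℝ) :
    ∫⁻ p, ENNReal.ofReal (exp (c * (v p.1 - v p.2))) ∂jointGaussian n ρ
      ≤ ENNReal.ofReal (exp (c ^ 2 * L ^ 2 * (1 - ρ))) := by
  have hv := measurable_of_le_mul_sqrt_sum_sq hLip
  set φ := arccos ρ / 2 with hφ
  have h2φ : 2 * φ = arccos ρ := by rw [hφ]; ring
  have hcos : ρ = 2 * cos φ ^ 2 - 1 := by rw [← cos_two_mul, h2φ, cos_arccos hρ.1 hρ.2]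
  have hsin : √(1 - ρ ^ 2) = 2 * sin φ * cos φ := by rw [← sin_two_mul, h2φ, sin_arccos]
  have hsc := sin_sq_add_cos_sq φ
  have hjoint : jointGaussian n ρ = ((_root_.stdGaussian n).prod (_root_.stdGaussian n)).map
      fun p => (cos φ • p.1 - sin φ • p.2, cos φ • p.1 + sin φ • p.2) := by
    rw [jointGaussian, ← map_rotation_stdGaussian n (-φ),
      Measure.map_map (by fun_prop) (by fun_prop),
      map_rotation_stdGaussian]
    congr 1
    ext p i
    · simp [ContinuousLinearMap.rotation_apply]
      ring
    · simp only [Function.comp_apply, ContinuousLinearMap.rotation_apply, cos_neg, sin_neg,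
        Pi.add_apply, Pi.smul_apply, smul_eq_mul, neg_neg, hsin]
      have hs : sin φ ^ 2 = 1 - cos φ ^ 2 := by linarith
      rw [hcos]
      linear_combination (2 * cos φ * p.1 i) * hs
  rw [hjoint, lintegral_map (by fun_prop) (by fun_prop), lintegral_prod _ (by fun_prop)]
  refine (lintegral_mono fun w => lintegral_exp_stdGaussian_le_of_odd
    (K := 2 * |c| * L * |sin φ|) (by fun_prop) (fun u => ?_) fun u u' => ?_).trans ?_
  · simp only [smul_neg, sub_neg_eq_add, ← sub_eq_add_neg]
    ring
  · have hscale : ∀ z z' : Fin n → ℝ, (∀ i, (z i - z' i) ^ 2 = (sin φ) ^ 2 * (u i - u' i) ^ 2) →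
        |v z - v z'| ≤ L * (|sin φ| * √(∑ i, (u i - u' i) ^ 2)) := fun z z' hz => by
      refine (hLip z z').trans_eq ?_
      rw [Finset.sum_congr rfl fun i _ => hz i, ← Finset.mul_sum, sqrt_mul (sq_nonneg _),
        sqrt_sq_eq_abs]
    have h1 := hscale (cos φ • w - sin φ • u) (cos φ • w - sin φ • u') fun i => by
      simp; ring
    have h2 := hscale (cos φ • w + sin φ • u) (cos φ • w + sin φ • u') fun i => by
      simp; ring
    rw [← mul_sub, abs_mul]
    calc |c| * _ ≤ |c| * (L * (|sin φ| * √(∑ i, (u i - u' i) ^ 2)) +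
          L * (|sin φ| * √(∑ i, (u i - u' i) ^ 2))) := by
          gcongr
          rw [sub_sub_sub_comm]
          exact (abs_sub _ _).trans (add_le_add h1 h2)
      _ = _ := by ring
  · rw [lintegral_const, measure_univ, mul_one]
    refine ENNReal.ofReal_le_ofReal (exp_le_exp.2 (le_of_eq ?_))
    rw [mul_pow, mul_pow, mul_pow, sq_abs, sq_abs, hcos]
    linear_combination (2 * c ^ 2 * L ^ 2) * hsc

lemma lintegral_exp_mul_gaussianReal (t : ℝ) :
    ∫⁻ z, ENNReal.ofReal (exp (z * t)) ∂gaussianReal 0 1 = ENNReal.ofReal (exp (t ^ 2 / 2)) := by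
  have h := congrFun (mgf_fun_id_gaussianReal (μ := 0) (v := 1)) t
  simp only [mgf, zero_mul, zero_add, NNReal.coe_one, one_mul] at h
  rw [← h, ofReal_integral_eq_lintegral_ofReal (integrable_exp_mul_gaussianReal t)
    (.of_forall fun _ => (exp_pos _).le)]
  simp_rw [mul_comm]

lemma lintegral_exp_mul_sq_gaussianReal {t : ℝ} (ht : 2 * t < 1) :
    ∫⁻ z, ENNReal.ofReal (exp (t * z ^ 2)) ∂gaussianReal 0 1
      = ENNReal.ofReal (1 / √(1 - 2 * t)) := by
  have hpos : 0 < 1 / 2 - t := by linarith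
  have hpos' : 0 < 1 - 2 * t := by linarith
  rw [gaussianReal_of_var_ne_zero 0 one_ne_zero, lintegral_withDensity_eq_lintegral_mul _
    (measurable_gaussianPDF 0 1) (by fun_prop)]
  have hprod : ∀ z, (gaussianPDF 0 1 * fun z => ENNReal.ofReal (exp (t * z ^ 2))) z
      = ENNReal.ofReal ((√(2 * π))⁻¹ * exp (-(1 / 2 - t) * z ^ 2)) := fun z => by
    rw [Pi.mul_apply, gaussianPDF, ← ENNReal.ofReal_mul (gaussianPDFReal_nonneg _ _ _),
      gaussianPDFReal_def]
    simp only [NNReal.coe_one, mul_one, sub_zero]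
    rw [mul_assoc, ← exp_add]
    ring_nf
  simp_rw [hprod]
  rw [← ofReal_integral_eq_lintegral_ofReal ((integrable_exp_neg_mul_sq hpos).const_mul _)
    (.of_forall fun _ => by positivity), integral_const_mul, integral_gaussian]
  congr 1
  rw [← sqrt_inv, ← sqrt_mul (by positivity), one_div (√_), ← sqrt_inv]
  congr 1
  have : 1 / 2 - t = (1 - 2 * t) / 2 := by ring
  rw [this]
  field_simp

/-- for L-Lipschitz v (Euclidean distance), ρ-correlated standard
Gaussians with 0 ≤ ρ < 1, and β > 0 with 4βL² < 1,
E_ρ exp(β(v(X) - v(Y))²/(1-ρ)) ≤ 1/√(1 - 4βL²). -/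
theorem lipschitz_correlated_exp_moment (n : ℕ) (v : (Fin n → ℝ) → ℝ) (L : ℝ)
    (hL : 0 ≤ L)
    (hLip : ∀ x y, |v x - v y| ≤ L * Real.sqrt (∑ i, (x i - y i) ^ 2))
    (ρ : ℝ) (hρ : ρ ∈ Set.Ico (0 : ℝ) 1) (β : ℝ) (hβ : 0 < β)
    (hβL : 4 * β * L ^ 2 < 1) :
    ∫ p, Real.exp (β * (v p.1 - v p.2) ^ 2 / (1 - ρ)) ∂(jointGaussian n ρ)
      ≤ 1 / Real.sqrt (1 - 4 * β * L ^ 2) := by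
  have hρ1 : 0 < 1 - ρ := sub_pos.2 hρ.2
  have hv := measurable_of_le_mul_sqrt_sum_sq hLip
  set c := √(2 * β / (1 - ρ)) with hc
  have hc2 : c ^ 2 = 2 * β / (1 - ρ) := sq_sqrt (by positivity)
  have : IsProbabilityMeasure (jointGaussian n ρ) :=
    Measure.isProbabilityMeasure_map (by fun_prop)
  have key : ∫⁻ p, ENNReal.ofReal (exp (β * (v p.1 - v p.2) ^ 2 / (1 - ρ))) ∂jointGaussian n ρ
      ≤ ENNReal.ofReal (1 / √(1 - 4 * β * L ^ 2)) := by
    calc ∫⁻ p, ENNReal.ofReal (exp (β * (v p.1 - v p.2) ^ 2 / (1 - ρ))) ∂jointGaussian n ρ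
        = ∫⁻ p, ∫⁻ z, ENNReal.ofReal (exp (z * (c * (v p.1 - v p.2)))) ∂gaussianReal 0 1
            ∂jointGaussian n ρ := by
          refine lintegral_congr fun p => ?_
          rw [lintegral_exp_mul_gaussianReal, mul_pow, hc2]
          congr 2
          ring
      _ = ∫⁻ z, ∫⁻ p, ENNReal.ofReal (exp (z * (c * (v p.1 - v p.2)))) ∂jointGaussian n ρ
            ∂gaussianReal 0 1 := lintegral_lintegral_swap (by fun_prop)
      _ ≤ ∫⁻ z, ENNReal.ofReal (exp (2 * β * L ^ 2 * z ^ 2)) ∂gaussianReal 0 1 := by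
          refine lintegral_mono fun z => ?_
          have h := lintegral_exp_sub_jointGaussian_le hLip
            (Set.mem_Icc.2 ⟨by linarith [hρ.1], hρ.2.le⟩) (z * c)
          simp only [mul_assoc] at h
          refine h.trans_eq ?_
          rw [mul_pow, hc2]
          congr 2
          field_simp
      _ = ENNReal.ofReal (1 / √(1 - 4 * β * L ^ 2)) := by
          rw [lintegral_exp_mul_sq_gaussianReal (by linarith)]
          ring_nf
  rw [integral_eq_lintegral_of_nonneg_ae (.of_forall fun _ => (exp_pos _).le)
    (Measurable.aestronglyMeasurable (by fun_prop))]
  exact ENNReal.toReal_le_of_le_ofReal (by positivity) key
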